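/- arXiv:1910.04276 — 2 statements merged into one kernel-verified Lean document; each statement's English description precedes it below -/
import Mathlib

section
/- Let (α,β) belong to the region A = {(α,β) ∈ (0,1)² : α+β < 1, and either α < 1 − β/(1−α−β) or β < 1 − α/(1−α−β)}, and let f be a Schwartz function on ℝ. If f(n^α) = f(-n^α) = 0 and f̂(n^β) = f̂(-n^β) = 0 for every natural number n ≥ 0, then f is identically zero. -/
open MeasureTheory

/-- The Fourier transform `f̂(ξ) = ∫_ℝ f(x) e^{2πi x ξ} dx`. -/
noncomputable def fourierTransform (f : ℝ → ℂ) (ξ : ℝ) : ℂ :=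
  ∫ x : ℝ, f x * Complex.exp (2 * Real.pi * Complex.I * x * ξ)

open Filter Topology
open scoped ContDiff FourierTransform SchwartzMap Nat

/-- Generalised Rolle theorem: a smooth function with `k + 1` zeros has a `k`-th derivative with a
zero. -/
theorem exists_iteratedDeriv_eq_zero (k : ℕ) {g : ℝ → ℝ} (hg : ContDiff ℝ ∞ g) {z : ℕ → ℝ}
    (hz : StrictMono z) (h0 : ∀ i ≤ k, g (z i) = 0) : ∃ c, iteratedDeriv k g c = 0 := by
  induction k generalizing g z with
  | zero => exact ⟨z 0, by simpa using h0 0 le_rfl⟩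
  | succ k ih =>
    have key (i : ℕ) : ∃ w ∈ Set.Ioo (z i) (z (i + 1)), i ≤ k → deriv g w = 0 := by
      by_cases hi : i ≤ k
      · obtain ⟨w, hw, hw0⟩ := exists_deriv_eq_zero (hz (Nat.lt_succ_self i))
          hg.continuous.continuousOn ((h0 i (by omega)).trans (h0 (i + 1) (by omega)).symm)
        exact ⟨w, hw, fun _ => hw0⟩
      · obtain ⟨w, hw⟩ := exists_between (hz (Nat.lt_succ_self i))
        exact ⟨w, hw, fun h => absurd h hi⟩
    choose w hw hw0 using key
    obtain ⟨c, hc⟩ := ih (g := deriv g) (z := w) (contDiff_infty_iff_deriv.1 hg).2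
      (strictMono_nat_of_lt_succ fun i => (hw i).2.trans (hw (i + 1)).1) hw0
    exact ⟨c, by rw [iteratedDeriv_succ', hc]⟩

theorem iteratedDeriv_polynomial_eval (P : Polynomial ℝ) (k : ℕ) :
    iteratedDeriv k (fun t => P.eval t) = fun t => (Polynomial.derivative^[k] P).eval t := by
  induction k with
  | zero => simp
  | succ k ih =>
    rw [iteratedDeriv_succ, ih]
    funext t
    rw [Polynomial.deriv, Function.iterate_succ_apply']

theorem iterate_derivative_of_monic {P : Polynomial ℝ} (hP : P.Monic) :
    Polynomial.derivative^[P.natDegree] P = Polynomial.C (P.natDegree ! : ℝ) := by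
  have hd : (Polynomial.derivative^[P.natDegree] P).natDegree = 0 := by
    have := Polynomial.natDegree_iterate_derivative P P.natDegree
    omega
  rw [Polynomial.eq_C_of_natDegree_eq_zero hd, Polynomial.coeff_iterate_derivative]
  simp [Nat.descFactorial_self, hP.coeff_natDegree]

/-- Error bound for Lagrange interpolation of a function vanishing at the nodes. -/
theorem abs_le_of_zeros {g : ℝ → ℝ} (hg : ContDiff ℝ ∞ g) {y : ℕ → ℝ} (hy : StrictMono y)
    {x : ℝ} (hx : x < y 0) {k : ℕ} (h0 : ∀ i < k, g (y i) = 0) {M : ℝ}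
    (hM : ∀ t, |iteratedDeriv k g t| ≤ M) :
    |g x| ≤ (∏ i ∈ Finset.range k, (y i - x)) / k ! * M := by
  set P : Polynomial ℝ := ∏ i ∈ Finset.range k, (Polynomial.X - Polynomial.C (y i)) with hPdef
  have hPm : P.Monic := Polynomial.monic_prod_of_monic _ _ fun i _ => Polynomial.monic_X_sub_C _
  have hPd : P.natDegree = k := by simp [hPdef, Polynomial.natDegree_prod_of_monic _ _
    (fun i _ => Polynomial.monic_X_sub_C (y i))]
  have hxy (i : ℕ) : x < y i := hx.trans_le (hy.monotone (Nat.zero_le i))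
  have hPx : |P.eval x| = ∏ i ∈ Finset.range k, (y i - x) := by
    rw [hPdef, Polynomial.eval_prod, Finset.abs_prod]
    refine Finset.prod_congr rfl fun i _ => ?_
    rw [Polynomial.eval_sub, Polynomial.eval_X, Polynomial.eval_C, abs_sub_comm, abs_of_pos]
    linarith [hxy i]
  have hpos : 0 < ∏ i ∈ Finset.range k, (y i - x) :=
    Finset.prod_pos fun i _ => sub_pos.2 (hxy i)
  have hPx0 : P.eval x ≠ 0 := abs_pos.1 (hPx ▸ hpos)
  set c := g x / P.eval x with hc
  have hPsmooth : ContDiff ℝ ∞ (fun t => P.eval t) := by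
    simpa [Polynomial.aeval_def, Polynomial.eval₂_eq_eval_map] using P.contDiff_aeval (𝕜 := ℝ) ∞
  set z : ℕ → ℝ := fun n => Nat.casesOn n x y with hz
  have hzmono : StrictMono z := strictMono_nat_of_lt_succ fun n => by
    cases n with
    | zero => exact hx
    | succ n => exact hy (Nat.lt_succ_self n)
  obtain ⟨t, ht⟩ := exists_iteratedDeriv_eq_zero k
    (g := fun t => g t - c * P.eval t) (hg.sub (contDiff_const.mul hPsmooth)) hzmono (by
      intro i hi
      cases i with
      | zero => simp [hz, hc, hPx0]
      | succ i =>
        have hPi : P.eval (y i) = 0 := by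
          rw [hPdef, Polynomial.eval_prod]
          exact Finset.prod_eq_zero (Finset.mem_range.2 hi) (by simp)
        simp [hz, h0 i hi, hPi])
  have hsub := iteratedDeriv_fun_sub (n := k) (x := t) (f := g) (g := fun t => c * P.eval t)
    (hg.contDiffAt.of_le (by exact_mod_cast le_top))
    ((contDiff_const.mul hPsmooth).contDiffAt.of_le (by exact_mod_cast le_top))
  have hder : iteratedDeriv k (fun t => P.eval t) t = (k ! : ℝ) := by
    have := iterate_derivative_of_monic hPm
    rw [hPd] at this
    simp only [iteratedDeriv_polynomial_eval, this, Polynomial.eval_C]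
  rw [hsub, iteratedDeriv_const_mul_field, hder] at ht
  have hgx : g x = P.eval x / k ! * iteratedDeriv k g t := by
    have hk : (k ! : ℝ) ≠ 0 := by positivity
    rw [sub_eq_zero.1 ht, hc]
    field_simp
  rw [hgx, abs_mul, abs_div, hPx, Nat.abs_cast]
  gcongr
  exact hM t

theorem norm_le_of_zeros {f : ℝ → ℂ} (hf : ContDiff ℝ ∞ f) {y : ℕ → ℝ} (hy : StrictMono y)
    {x : ℝ} (hx : x < y 0) {k : ℕ} (h0 : ∀ i < k, f (y i) = 0) {M : ℝ}
    (hM : ∀ t, ‖iteratedDeriv k f t‖ ≤ M) :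
    ‖f x‖ ≤ 2 * ((∏ i ∈ Finset.range k, (y i - x)) / k ! * M) := by
  have key (L : ℂ →L[ℝ] ℝ) (hL : ∀ w, |L w| ≤ ‖w‖) :
      |L (f x)| ≤ (∏ i ∈ Finset.range k, (y i - x)) / k ! * M := by
    refine abs_le_of_zeros (g := fun t => L (f t)) (L.contDiff.comp hf) hy hx
      (fun i hi => by simp [h0 i hi]) fun t => ?_
    have : iteratedDeriv k (fun t => L (f t)) t = L (iteratedDeriv k f t) := by
      have := L.iteratedFDeriv_comp_left (f := f) (x := t) (n := ∞) (i := k)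
        hf.contDiffAt (by exact_mod_cast le_top)
      simp only [iteratedDeriv_eq_iteratedFDeriv]
      exact congrArg (fun T => T fun _ => 1) this
    rw [this]
    exact (hL _).trans (hM t)
  have h1 := key Complex.reCLM Complex.abs_re_le_norm
  have h2 := key Complex.imCLM Complex.abs_im_le_norm
  have h3 := Complex.norm_le_abs_re_add_abs_im (f x)
  simp only [Complex.reCLM_apply, Complex.imCLM_apply] at h1 h2
  linarith

theorem rpow_sub_rpow_le {α : ℝ} (hα0 : 0 < α) (hα1 : α < 1) (N i : ℕ) :
    ((N + (i + 1) : ℕ) : ℝ) ^ α - (N : ℝ) ^ α ≤ (i + 1) * ((N : ℝ) + 1) ^ (α - 1) := by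
  set M : ℝ := (N : ℝ) + 1 with hM
  have hM0 : 0 < M := by positivity
  have hMα : M ^ α = M * M ^ (α - 1) := by
    rw [Real.rpow_sub_one hM0.ne']; field_simp
  have h1 : ((N + (i + 1) : ℕ) : ℝ) ^ α ≤ M ^ α + i * M ^ (α - 1) := by
    have e : ((N + (i + 1) : ℕ) : ℝ) = M * (1 + i / M) := by
      push_cast; field_simp; simp [hM]; ring
    have hi : (0 : ℝ) ≤ i / M := by positivity
    rw [e, Real.mul_rpow hM0.le (by positivity)]
    have hb := rpow_one_add_le_one_add_mul_self (s := i / M) (by linarith) hα0.le hα1.le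
    have hb' : (1 + i / M) ^ α ≤ 1 + i / M := hb.trans (by nlinarith)
    calc M ^ α * (1 + i / M) ^ α ≤ M ^ α * (1 + i / M) := by gcongr
      _ = M ^ α + i * M ^ (α - 1) := by rw [hMα]; field_simp
  have h2 : M ^ α - M ^ (α - 1) ≤ (N : ℝ) ^ α := by
    have hN : (N : ℝ) = M * (N / M) := by field_simp
    have hle : (N : ℝ) / M ≤ 1 := by rw [div_le_one hM0]; linarith
    rw [hN, Real.mul_rpow hM0.le (by positivity)]
    have : (N : ℝ) / M ≤ (N / M) ^ α := by
      rcases Nat.eq_zero_or_pos N with h | h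
      · subst h; simp [Real.zero_rpow hα0.ne']
      · exact Real.self_le_rpow_of_le_one (by positivity) hle hα1.le
    calc M ^ α - M ^ (α - 1) = M ^ α * (N / M) := by
          rw [hMα]; field_simp; linarith
      _ ≤ _ := by gcongr
  linarith

/-- A Schwartz function vanishing at the points `n ^ α` is controlled at `x` by the zeros
following `x`. -/
theorem norm_le_prod_seminorm {α : ℝ} (hα0 : 0 < α) (f : 𝓢(ℝ, ℂ))
    (hf : ∀ n : ℕ, f ((n : ℝ) ^ α) = 0) {x : ℝ} {N : ℕ} (hN : (N : ℝ) ^ α ≤ x)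
    (hN' : x < ((N + 1 : ℕ) : ℝ) ^ α) (k : ℕ) :
    ‖f x‖ ≤ 2 * ((∏ i ∈ Finset.range k, (((N + (i + 1) : ℕ) : ℝ) ^ α - (N : ℝ) ^ α)) / k ! *
      SchwartzMap.seminorm ℝ 0 k f) := by
  have hy : StrictMono fun i : ℕ => ((N + (i + 1) : ℕ) : ℝ) ^ α := fun i j hij =>
    Real.rpow_lt_rpow (by positivity) (by exact_mod_cast (by omega)) hα0
  refine (norm_le_of_zeros (f.smooth ⊤) hy (x := x) (by simpa using hN') (k := k)
    (fun i _ => hf _) (M := SchwartzMap.seminorm ℝ 0 k f) fun t => ?_).trans ?_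
  · simpa using f.le_seminorm' ℝ 0 k t
  · have hprod : ∏ i ∈ Finset.range k, (((N + (i + 1) : ℕ) : ℝ) ^ α - x) ≤
        ∏ i ∈ Finset.range k, (((N + (i + 1) : ℕ) : ℝ) ^ α - (N : ℝ) ^ α) :=
      Finset.prod_le_prod
        (fun i _ => sub_nonneg.2 (hN'.le.trans (hy.monotone (Nat.zero_le i))))
        fun i _ => by gcongr
    have hD : 0 ≤ SchwartzMap.seminorm ℝ 0 k f := apply_nonneg _ _
    gcongr

theorem exists_nat_rpow_le_lt {α : ℝ} (hα0 : 0 < α) {x : ℝ} (hx : 0 ≤ x) :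
    ∃ N : ℕ, (N : ℝ) ^ α ≤ x ∧ x < ((N + 1 : ℕ) : ℝ) ^ α := by
  have hx' : 0 ≤ x ^ α⁻¹ := by positivity
  have e : (x ^ α⁻¹) ^ α = x := Real.rpow_inv_rpow hx hα0.ne'
  refine ⟨⌊x ^ α⁻¹⌋₊, ?_, ?_⟩
  · calc _ ≤ (x ^ α⁻¹) ^ α := Real.rpow_le_rpow (by positivity) (Nat.floor_le hx') hα0.le
      _ = x := e
  · calc x = (x ^ α⁻¹) ^ α := e.symm
      _ < _ := Real.rpow_lt_rpow hx' (by push_cast; exact Nat.lt_floor_add_one _) hα0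

/-- Decay of a Schwartz function vanishing at the points `n ^ α`. -/
theorem norm_le_rpow_mul_seminorm {α : ℝ} (hα0 : 0 < α) (hα1 : α < 1) (f : 𝓢(ℝ, ℂ))
    (hf : ∀ n : ℕ, f ((n : ℝ) ^ α) = 0) {x : ℝ} (hx : 0 ≤ x) (k : ℕ) :
    ‖f x‖ ≤ 2 * ((max 1 x) ^ (-((1 - α) / α * k)) * SchwartzMap.seminorm ℝ 0 k f) := by
  obtain ⟨N, hN, hN'⟩ := exists_nat_rpow_le_lt hα0 hx
  refine (norm_le_prod_seminorm hα0 f hf hN hN' k).trans ?_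
  have hM0 : (0 : ℝ) < (N : ℝ) + 1 := by positivity
  have hprod : (∏ i ∈ Finset.range k, (((N + (i + 1) : ℕ) : ℝ) ^ α - (N : ℝ) ^ α)) ≤
      k ! * (((N : ℝ) + 1) ^ (α - 1)) ^ k := by
    calc _ ≤ ∏ i ∈ Finset.range k, (((i : ℝ) + 1) * ((N : ℝ) + 1) ^ (α - 1)) := by
          refine Finset.prod_le_prod (fun i _ => ?_) fun i _ => rpow_sub_rpow_le hα0 hα1 N i
          exact sub_nonneg.2 (Real.rpow_le_rpow (by positivity)
            (by exact_mod_cast Nat.le_add_right N (i + 1)) hα0.le)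
      _ = _ := by
          rw [Finset.prod_mul_distrib, Finset.prod_const, Finset.card_range,
            ← Finset.prod_range_add_one_eq_factorial]
          push_cast
          rfl
  have hpow : (((N : ℝ) + 1) ^ (α - 1)) ^ k ≤ (max 1 x) ^ (-((1 - α) / α * k)) := by
    have hmax : max 1 x ≤ ((N : ℝ) + 1) ^ α :=
      max_le (Real.one_le_rpow (by linarith [Nat.cast_nonneg (α := ℝ) N]) hα0.le)
        (by exact_mod_cast hN'.le)
    have e : (((N : ℝ) + 1) ^ (α - 1)) ^ k = (((N : ℝ) + 1) ^ α) ^ (-((1 - α) / α * k)) := by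
      rw [← Real.rpow_natCast, ← Real.rpow_mul hM0.le, ← Real.rpow_mul hM0.le]
      congr 1
      field_simp
      ring
    rw [e]
    refine Real.rpow_le_rpow_of_nonpos (by positivity) hmax ?_
    have : 0 ≤ (1 - α) / α * k := by
      have : 0 ≤ 1 - α := by linarith
      positivity
    linarith
  have hD : 0 ≤ SchwartzMap.seminorm ℝ 0 k f := apply_nonneg _ _
  have hk : (0 : ℝ) < k ! := by positivity
  gcongr
  rw [div_le_iff₀ hk]
  calc _ ≤ _ := hprod
    _ ≤ _ := by rw [mul_comm]; gcongr

/-- Variant of `norm_le_rpow_mul_seminorm` adapted to small `x`. -/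
theorem norm_le_factorial_rpow_mul_seminorm {α : ℝ} (hα0 : 0 < α) (hα1 : α < 1) (f : 𝓢(ℝ, ℂ))
    (hf : ∀ n : ℕ, f ((n : ℝ) ^ α) = 0) {x : ℝ} (hx : 0 ≤ x) (k : ℕ) :
    ‖f x‖ ≤ 2 * ((k ! : ℝ) ^ α / k ! * SchwartzMap.seminorm ℝ 0 k f) := by
  obtain ⟨N, hN, hN'⟩ := exists_nat_rpow_le_lt hα0 hx
  refine (norm_le_prod_seminorm hα0 f hf hN hN' k).trans ?_
  have hD : 0 ≤ SchwartzMap.seminorm ℝ 0 k f := apply_nonneg _ _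
  gcongr
  rw [← Finset.prod_range_add_one_eq_factorial]
  push_cast
  rw [← Real.finsetProd_rpow _ _ fun i _ => add_nonneg (Nat.cast_nonneg i) zero_le_one]
  refine Finset.prod_le_prod (fun i _ => ?_) fun i _ => ?_
  · exact sub_nonneg.2 (Real.rpow_le_rpow (Nat.cast_nonneg N)
      (by linarith [Nat.cast_nonneg (α := ℝ) i]) hα0.le)
  · have := Real.rpow_add_le_add_rpow (a := (N : ℝ)) (b := (i : ℝ) + 1) (by positivity)
      (by positivity) hα0.le hα1.le
    linarith

/-- The reflection `x ↦ f (-x)` of a Schwartz function. -/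
noncomputable def reflect (f : 𝓢(ℝ, ℂ)) : 𝓢(ℝ, ℂ) :=
  SchwartzMap.compCLMOfContinuousLinearEquiv ℝ (ContinuousLinearEquiv.neg ℝ) f

theorem reflect_apply (f : 𝓢(ℝ, ℂ)) (x : ℝ) : reflect f x = f (-x) := by
  simp [reflect]

theorem seminorm_reflect_le (f : 𝓢(ℝ, ℂ)) (k : ℕ) :
    SchwartzMap.seminorm ℝ 0 k (reflect f) ≤ SchwartzMap.seminorm ℝ 0 k f := by
  refine SchwartzMap.seminorm_le_bound' ℝ 0 k _ (apply_nonneg _ _) fun x => ?_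
  have : (reflect f : ℝ → ℂ) = fun x => f (-x) := funext (reflect_apply f)
  rw [this, iteratedDeriv_comp_neg]
  simpa [norm_smul] using f.le_seminorm' ℝ 0 k (-x)

theorem norm_le_rpow_abs_mul_seminorm {α : ℝ} (hα0 : 0 < α) (hα1 : α < 1) (f : 𝓢(ℝ, ℂ))
    (hf : ∀ n : ℕ, f ((n : ℝ) ^ α) = 0 ∧ f (-(n : ℝ) ^ α) = 0) (x : ℝ) (k : ℕ) :
    ‖f x‖ ≤ 2 * ((max 1 |x|) ^ (-((1 - α) / α * k)) * SchwartzMap.seminorm ℝ 0 k f) := by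
  rcases le_total 0 x with hx | hx
  · rw [abs_of_nonneg hx]
    exact norm_le_rpow_mul_seminorm hα0 hα1 f (fun n => (hf n).1) hx k
  · have h := norm_le_rpow_mul_seminorm hα0 hα1 (reflect f)
      (fun n => by rw [reflect_apply]; exact (hf n).2) (neg_nonneg.2 hx) k
    rw [reflect_apply, neg_neg] at h
    rw [abs_of_nonpos hx]
    refine h.trans ?_
    gcongr
    exact seminorm_reflect_le f k

theorem max_one_abs_rpow_le {x s : ℝ} (j : ℕ) (hs : (j : ℝ) + 2 ≤ s) :
    |x| ^ j * (max 1 |x|) ^ (-s) ≤ 2 * (1 + x ^ 2)⁻¹ := by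
  set m := max 1 |x| with hm
  have h1 : 1 ≤ m := le_max_left _ _
  have hx : |x| ≤ m := le_max_right _ _
  calc |x| ^ j * m ^ (-s) ≤ m ^ j * m ^ (-((j : ℝ) + 2)) := by gcongr
    _ = (m ^ 2)⁻¹ := by
        rw [Real.rpow_neg (by positivity), Real.rpow_add (by positivity)]
        have : m ≠ 0 := by positivity
        norm_num
        field_simp
    _ ≤ 2 * (1 + x ^ 2)⁻¹ := by
        rw [← div_eq_mul_inv, inv_le_iff_one_le_mul₀ (by positivity), div_mul_eq_mul_div,
          one_le_div (by positivity)]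
        have : x ^ 2 ≤ m ^ 2 := by rw [← sq_abs]; gcongr
        nlinarith

theorem seminorm_fourier_le {α : ℝ} (hα0 : 0 < α) (hα1 : α < 1) (f : 𝓢(ℝ, ℂ))
    (hf : ∀ n : ℕ, f ((n : ℝ) ^ α) = 0 ∧ f (-(n : ℝ) ^ α) = 0) (i j : ℕ)
    (hij : (j : ℝ) + 2 ≤ (1 - α) / α * i) :
    SchwartzMap.seminorm ℝ 0 j (𝓕 f) ≤ 16 ^ (j + 1) * SchwartzMap.seminorm ℝ 0 i f := by
  have hD : 0 ≤ SchwartzMap.seminorm ℝ 0 i f := apply_nonneg _ _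
  set D := SchwartzMap.seminorm ℝ 0 i f
  refine SchwartzMap.seminorm_le_bound' ℝ 0 j _ (by positivity) fun ξ => ?_
  rw [pow_zero, one_mul, SchwartzMap.fourier_coe,
    Real.iteratedDeriv_fourier (N := ⊤) (fun n _ => ?_) (by exact_mod_cast le_top)]
  swap
  · have := f.integrable_pow_mul volume n
    refine (integrable_norm_iff (by fun_prop)).1 (this.congr (ae_of_all _ fun x => ?_))
    simp
  refine (VectorFourier.norm_fourierIntegral_le_integral_norm _ _ _ _ _).trans ?_
  have hbound (x : ℝ) : ‖(-2 * Real.pi * Complex.I * x) ^ j • f x‖ ≤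
      ((2 * Real.pi) ^ j * (4 * D)) * (1 + x ^ 2)⁻¹ := by
    have h1 := norm_le_rpow_abs_mul_seminorm hα0 hα1 f hf x i
    have h2 := max_one_abs_rpow_le (x := x) j hij
    have h3 : ‖(-2 * Real.pi * Complex.I * x) ^ j • f x‖ = (2 * Real.pi) ^ j * (|x| ^ j * ‖f x‖) := by
      simp [mul_pow, abs_of_pos Real.pi_pos]
      ring
    rw [h3, mul_assoc]
    refine mul_le_mul_of_nonneg_left ?_ (by positivity)
    calc |x| ^ j * ‖f x‖ ≤ |x| ^ j * (2 * (max 1 |x| ^ (-((1 - α) / α * i)) * D)) := by gcongr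
      _ = (|x| ^ j * max 1 |x| ^ (-((1 - α) / α * i))) * (2 * D) := by ring
      _ ≤ (2 * (1 + x ^ 2)⁻¹) * (2 * D) := by gcongr
      _ = _ := by ring
  calc ∫ x : ℝ, ‖(-2 * Real.pi * Complex.I * x) ^ j • f x‖
      ≤ ∫ x : ℝ, ((2 * Real.pi) ^ j * (4 * D)) * (1 + x ^ 2)⁻¹ :=
        integral_mono_of_nonneg (ae_of_all _ fun x => norm_nonneg _)
          (integrable_inv_one_add_sq.const_mul _) (ae_of_all _ hbound)
    _ = (2 * Real.pi) ^ j * (4 * Real.pi) * D := by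
        rw [integral_const_mul, integral_univ_inv_one_add_sq]; ring
    _ ≤ 16 ^ j * 16 * D := by
        have := Real.pi_le_four
        gcongr <;> linarith
    _ = _ := by ring

/-- A sequence satisfying `D k ≤ K ^ (k + 1) * D i` for some `i ≤ ρ k` with `ρ < 1` grows at most
geometrically. -/
theorem exists_le_mul_pow {D : ℕ → ℝ} (hD : ∀ k, 0 ≤ D k) {K ρ : ℝ} (hK : 1 ≤ K) (hρ : ρ < 1)
    {K₀ : ℕ} (h : ∀ k ≥ K₀, ∃ i : ℕ, (i : ℝ) ≤ ρ * k ∧ D k ≤ K ^ (k + 1) * D i) :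
    ∃ A H : ℝ, ∀ k, D k ≤ A * H ^ k := by
  obtain ⟨r, hr⟩ := exists_nat_ge (2 / (1 - ρ))
  rw [div_le_iff₀ (by linarith)] at hr
  have hA : 0 ≤ ∑ i ∈ Finset.range (K₀ + 1), D i := Finset.sum_nonneg fun i _ => hD i
  have hH : 1 ≤ K ^ r := one_le_pow₀ hK
  refine ⟨∑ i ∈ Finset.range (K₀ + 1), D i, K ^ r, fun k => ?_⟩
  induction k using Nat.strong_induction_on with
  | _ k ih =>
    rcases le_or_gt k K₀ with hk | hk
    · calc D k ≤ ∑ i ∈ Finset.range (K₀ + 1), D i :=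
            Finset.single_le_sum (fun i _ => hD i) (Finset.mem_range.2 (by omega))
        _ ≤ _ := le_mul_of_one_le_right hA (one_le_pow₀ hH)
    · obtain ⟨i, hi, hDi⟩ := h k hk.le
      have hk1 : (1 : ℝ) ≤ k := by exact_mod_cast (by omega : 1 ≤ k)
      have hik : i < k := by
        have : (i : ℝ) < k := by nlinarith
        exact_mod_cast this
      have hexp : k + 1 + r * i ≤ r * k := by
        have : (k : ℝ) + 1 + r * i ≤ r * k := by
          have := mul_le_mul_of_nonneg_left hi (Nat.cast_nonneg (α := ℝ) r)
          nlinarith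
        exact_mod_cast this
      calc D k ≤ K ^ (k + 1) * D i := hDi
        _ ≤ K ^ (k + 1) * ((∑ i ∈ Finset.range (K₀ + 1), D i) * (K ^ r) ^ i) := by
            gcongr; exact ih i hik
        _ = (∑ i ∈ Finset.range (K₀ + 1), D i) * K ^ (k + 1 + r * i) := by
            rw [pow_add K (k + 1), pow_mul]; ring
        _ ≤ (∑ i ∈ Finset.range (K₀ + 1), D i) * K ^ (r * k) := by gcongr
        _ = _ := by rw [pow_mul]

theorem fourierTransform_eq_fourier_neg (f : 𝓢(ℝ, ℂ)) (ξ : ℝ) :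
    fourierTransform f ξ = 𝓕 f (-ξ) := by
  rw [SchwartzMap.fourier_coe, Real.fourier_real_eq_integral_exp_smul, fourierTransform]
  refine integral_congr_ae (ae_of_all _ fun x => ?_)
  simp only [smul_eq_mul]
  rw [mul_comm]
  congr 2
  push_cast
  ring

theorem fourier_fourier_eq_reflect (f : 𝓢(ℝ, ℂ)) : 𝓕 (𝓕 f) = reflect f := by
  ext x
  have h : (𝓕⁻ (𝓕 f) : 𝓢(ℝ, ℂ)) (-x) = f (-x) := by
    rw [FourierTransform.fourierInv_fourier_eq]
  rw [reflect_apply, ← h, SchwartzMap.fourierInv_coe, Real.fourierInv_eq_fourier_neg, neg_neg,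
    SchwartzMap.fourier_coe (𝓕 f)]

/-- If `f` and its Fourier transform vanish at `± n ^ α` and `± n ^ β` with `α + β < 1`, the
derivatives of `f` grow at most geometrically. -/
theorem exists_seminorm_le_mul_pow {α β : ℝ} (hα : α ∈ Set.Ioo (0 : ℝ) 1)
    (hβ : β ∈ Set.Ioo (0 : ℝ) 1) (hsum : α + β < 1) (f : 𝓢(ℝ, ℂ))
    (hf : ∀ n : ℕ, f ((n : ℝ) ^ α) = 0 ∧ f (-(n : ℝ) ^ α) = 0)
    (hfhat : ∀ n : ℕ, 𝓕 f ((n : ℝ) ^ β) = 0 ∧ 𝓕 f (-(n : ℝ) ^ β) = 0) :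
    ∃ A H : ℝ, ∀ k, SchwartzMap.seminorm ℝ 0 k f ≤ A * H ^ k := by
  obtain ⟨hα0, hα1⟩ := hα
  obtain ⟨hβ0, hβ1⟩ := hβ
  set p := (1 - α) / α with hp
  set q := (1 - β) / β with hq
  have hp0 : 0 < p := div_pos (by linarith) hα0
  have hq0 : 0 < q := div_pos (by linarith) hβ0
  have hpq : 1 < p * q := by
    rw [hp, hq, div_mul_div_comm, one_lt_div (by positivity)]
    nlinarith
  set J : ℕ → ℕ := fun k => ⌈((k : ℝ) + 2) / q⌉₊ with hJ
  set I : ℕ → ℕ := fun k => ⌈((J k : ℝ) + 2) / p⌉₊ with hI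
  have hJ1 (k : ℕ) : (k : ℝ) + 2 ≤ q * J k := by
    rw [mul_comm, ← div_le_iff₀ hq0]; exact Nat.le_ceil _
  have hJ2 (k : ℕ) : (J k : ℝ) ≤ ((k : ℝ) + 2) / q + 1 :=
    (Nat.ceil_lt_add_one (by positivity)).le
  have hI1 (k : ℕ) : (J k : ℝ) + 2 ≤ p * I k := by
    rw [mul_comm, ← div_le_iff₀ hp0]; exact Nat.le_ceil _
  have hI2 (k : ℕ) : (I k : ℝ) ≤ ((J k : ℝ) + 2) / p + 1 :=
    (Nat.ceil_lt_add_one (by positivity)).le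
  have hstep (k : ℕ) : SchwartzMap.seminorm ℝ 0 k f ≤
      16 ^ (k + 1 + (J k + 1)) * SchwartzMap.seminorm ℝ 0 (I k) f := by
    have h1 := seminorm_fourier_le hα0 hα1 f hf (I k) (J k) (hI1 k)
    have h2 := seminorm_fourier_le hβ0 hβ1 (𝓕 f) hfhat (J k) k (hJ1 k)
    have h3 := seminorm_reflect_le (reflect f) k
    have h4 : reflect (reflect f) = f := by ext x; simp [reflect_apply]
    rw [h4] at h3
    rw [fourier_fourier_eq_reflect] at h2
    calc _ ≤ _ := h3.trans h2
      _ ≤ 16 ^ (k + 1) * (16 ^ (J k + 1) * SchwartzMap.seminorm ℝ 0 (I k) f) := by gcongr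
      _ = _ := by rw [pow_add]; ring
  obtain ⟨m, hm⟩ := exists_nat_ge (1 + 2 / q + 2)
  have hJm (k : ℕ) : k + 1 + (J k + 1) ≤ m * (k + 1) := by
    have h1 : ((k : ℝ) + 2) / q ≤ 2 / q * (k + 1) := by
      rw [div_mul_eq_mul_div]; gcongr; linarith [Nat.cast_nonneg (α := ℝ) k]
    have h2 : (k : ℝ) + 1 + (J k + 1) ≤ m * (k + 1) := by
      have := mul_le_mul_of_nonneg_right hm (by positivity : (0 : ℝ) ≤ (k : ℝ) + 1)
      nlinarith [hJ2 k, Nat.cast_nonneg (α := ℝ) k]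
    exact_mod_cast h2
  set c := (2 / q + 3) / p + 1 with hc
  have hIc (k : ℕ) : (I k : ℝ) ≤ k / (p * q) + c := by
    have h1 : ((J k : ℝ) + 2) / p ≤ (((k : ℝ) + 2) / q + 1 + 2) / p := by
      gcongr; exact hJ2 k
    refine (hI2 k).trans ((add_le_add_left h1 1).trans (le_of_eq ?_))
    rw [hc]; field_simp; ring
  set θ := (p * q)⁻¹ with hθ
  have hθ1 : θ < 1 := inv_lt_one_of_one_lt₀ hpq
  obtain ⟨K₀, hK₀⟩ := exists_nat_ge (2 * c / (1 - θ))
  refine exists_le_mul_pow (fun k => apply_nonneg _ _) (K := 16 ^ m) (ρ := (1 + θ) / 2)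
    (one_le_pow₀ (by norm_num)) (by linarith) (K₀ := K₀) fun k hk => ⟨I k, ?_, ?_⟩
  · have h1 : 2 * c / (1 - θ) ≤ k := hK₀.trans (by exact_mod_cast hk)
    rw [div_le_iff₀ (by linarith)] at h1
    have h2 := hIc k
    rw [div_eq_mul_inv, ← hθ] at h2
    linarith
  · refine (hstep k).trans ?_
    rw [← pow_mul]
    gcongr
    · norm_num
    · exact hJm k

theorem eq_zero_of_seminorm_le_mul_pow {α : ℝ} (hα0 : 0 < α) (hα1 : α < 1) (f : 𝓢(ℝ, ℂ))
    (hf : ∀ n : ℕ, f ((n : ℝ) ^ α) = 0) {A H : ℝ}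
    (hAH : ∀ k, SchwartzMap.seminorm ℝ 0 k f ≤ A * H ^ k) {x : ℝ} (hx : 0 ≤ x) : f x = 0 := by
  have hs : 0 < 1 - α := by linarith
  set B := |H| ^ (1 - α)⁻¹ with hB
  have hBH : B ^ (1 - α) = |H| := Real.rpow_inv_rpow (abs_nonneg H) hs.ne'
  have hlim : Tendsto (fun k : ℕ => 2 * |A| * (B ^ k / (k ! : ℝ)) ^ (1 - α)) atTop (𝓝 0) := by
    have := ((FloorSemiring.tendsto_pow_div_factorial_atTop B).rpow_const
      (p := 1 - α) (Or.inr hs.le)).const_mul (2 * |A|)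
    simpa [Real.zero_rpow hs.ne'] using this
  have hle (k : ℕ) : ‖f x‖ ≤ 2 * |A| * (B ^ k / (k ! : ℝ)) ^ (1 - α) := by
    have hk : (0 : ℝ) < k ! := by positivity
    have hB0 : 0 ≤ B := by positivity
    have e : (B ^ k / (k ! : ℝ)) ^ (1 - α) = |H| ^ k * ((k ! : ℝ) ^ α / k !) := by
      rw [Real.div_rpow (by positivity) hk.le, ← Real.rpow_natCast B, ← Real.rpow_mul hB0,
        mul_comm, Real.rpow_mul hB0, hBH, Real.rpow_natCast, Real.rpow_sub hk, Real.rpow_one]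
      field_simp
    have h1 : SchwartzMap.seminorm ℝ 0 k f ≤ |A| * |H| ^ k :=
      (hAH k).trans ((le_abs_self _).trans (by rw [abs_mul, abs_pow]))
    calc _ ≤ _ := norm_le_factorial_rpow_mul_seminorm hα0 hα1 f hf hx k
      _ ≤ 2 * ((k ! : ℝ) ^ α / k ! * (|A| * |H| ^ k)) := by gcongr
      _ = _ := by rw [e]; ring
  exact norm_le_zero_iff.1 (ge_of_tendsto' hlim hle)

theorem uniqueness_pair_powers (α β : ℝ)
    (hα : α ∈ Set.Ioo (0 : ℝ) 1) (hβ : β ∈ Set.Ioo (0 : ℝ) 1)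
    (hsum : α + β < 1)
    (hregion : α < 1 - β / (1 - α - β) ∨ β < 1 - α / (1 - α - β))
    (f : SchwartzMap ℝ ℂ)
    (hf : ∀ n : ℕ, f ((n : ℝ) ^ α) = 0 ∧ f (-(n : ℝ) ^ α) = 0)
    (hfhat : ∀ n : ℕ, fourierTransform f ((n : ℝ) ^ β) = 0 ∧
      fourierTransform f (-(n : ℝ) ^ β) = 0) :
    ∀ x : ℝ, f x = 0 := by
  obtain ⟨A, H, hAH⟩ := exists_seminorm_le_mul_pow hα hβ hsum f hf fun n => by
    have h := hfhat n
    simp only [fourierTransform_eq_fourier_neg, neg_neg] at h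
    exact h.symm
  intro x
  rcases le_total 0 x with hx | hx
  · exact eq_zero_of_seminorm_le_mul_pow hα.1 hα.2 f (fun n => (hf n).1) hAH hx
  · have h := eq_zero_of_seminorm_le_mul_pow hα.1 hα.2 (reflect f)
      (fun n => by rw [reflect_apply]; exact (hf n).2)
      (fun k => (seminorm_reflect_le f k).trans (hAH k)) (neg_nonneg.2 hx)
    rwa [reflect_apply, neg_neg] at h
end

section
/- Let 0 < α < 1 and let f be a Schwartz function on ℝ with f(log(n+1)) = f(-log(n+1)) = 0 and f̂(n^α) = f̂(-n^α) = 0 for every natural number n ≥ 0. Then f has superexponential decay of every order: for every A > 1 there exist constants C_A, c_A > 0 such that |f(x)| ≤ C_A e^{−c_A |x|^A} for all x ∈ ℝ. -/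
open MeasureTheory

open scoped FourierTransform

/-- The function `g` decays like `(1 + |x|) ^ (-m)`, with constant `B`. -/
def WeightedBound (g : ℝ → ℂ) (m : ℕ) (B : ℝ) : Prop :=
  ∀ x : ℝ, (1 + |x|) ^ m * ‖g x‖ ≤ B

lemma WeightedBound.nonneg {g : ℝ → ℂ} {m : ℕ} {B : ℝ} (h : WeightedBound g m B) : 0 ≤ B :=
  le_trans (by positivity) (h 0)

lemma WeightedBound.mono {g : ℝ → ℂ} {m n : ℕ} {B : ℝ} (h : WeightedBound g n B)
    (hmn : m ≤ n) : WeightedBound g m B := fun x ↦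
  le_trans (mul_le_mul_of_nonneg_right
    (pow_le_pow_right₀ (by linarith [abs_nonneg x]) hmn) (norm_nonneg _)) (h x)

lemma WeightedBound.comp_neg {g : ℝ → ℂ} {m : ℕ} {B : ℝ} (h : WeightedBound g m B) :
    WeightedBound (fun x ↦ g (-x)) m B := fun x ↦ by
  simpa using h (-x)

lemma SchwartzMap.exists_weightedBound (g : SchwartzMap ℝ ℂ) (m : ℕ) :
    ∃ B, WeightedBound g m B := by
  refine ⟨2 ^ m * (Finset.Iic (m, 0)).sup (fun i ↦ SchwartzMap.seminorm ℝ i.1 i.2) g, fun x ↦ ?_⟩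
  simpa using SchwartzMap.one_add_le_sup_seminorm_apply (𝕜 := ℝ) (m := (m, 0)) le_rfl le_rfl g x

/-- Iterated Rolle: a function with `k` zeros in `[a, b]` is controlled by its `k`-th derivative. -/
lemma abs_le_of_zeros_of_hasDerivAt (k : ℕ) {G : ℕ → ℝ → ℝ}
    (hG : ∀ j x, HasDerivAt (G j) (G (j + 1) x) x) {a b D : ℝ} {z : ℕ → ℝ}
    (hz : ∀ i, i + 1 < k → z i < z (i + 1)) (hzmem : ∀ i < k, z i ∈ Set.Icc a b)
    (hzero : ∀ i < k, G 0 (z i) = 0) (hD : ∀ x ∈ Set.Icc a b, |G k x| ≤ D) :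
    ∀ x ∈ Set.Icc a b, |G 0 x| ≤ (b - a) ^ k * D := by
  induction k generalizing G z with
  | zero => simpa using hD
  | succ k ih =>
    have hroll : ∀ i, ∃ w, i < k → w ∈ Set.Ioo (z i) (z (i + 1)) ∧ G 1 w = 0 := by
      intro i
      by_cases hi : i < k
      · obtain ⟨w, hw, hw0⟩ := exists_hasDerivAt_eq_zero (f := G 0) (f' := G 1)
          (hz i (by omega))
          (fun x _ ↦ (hG 0 x).continuousAt.continuousWithinAt)
          (by rw [hzero i (by omega), hzero (i + 1) (by omega)]) (fun x _ ↦ hG 0 x)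
        exact ⟨w, fun _ ↦ ⟨hw, hw0⟩⟩
      · exact ⟨0, fun h ↦ absurd h hi⟩
    choose w hw using hroll
    have hderiv : ∀ x ∈ Set.Icc a b, |G 1 x| ≤ (b - a) ^ k * D := by
      refine ih (G := fun j ↦ G (j + 1)) (z := w) (fun j x ↦ hG (j + 1) x) ?_ ?_ ?_ hD
      · intro i hi
        exact (hw i (by omega)).1.2.trans (hw (i + 1) hi).1.1
      · intro i hi
        exact ⟨(hzmem i (by omega)).1.trans (hw i hi).1.1.le,
          (hw i hi).1.2.le.trans (hzmem (i + 1) (by omega)).2⟩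
      · exact fun i hi ↦ (hw i hi).2
    intro x hx
    have hz0 := hzmem 0 (by omega)
    have hmvt := Convex.norm_image_sub_le_of_norm_hasDerivWithin_le (f := G 0) (f' := G 1)
      (fun y _ ↦ (hG 0 y).hasDerivWithinAt) (fun y hy ↦ hderiv y hy) (convex_Icc a b) hz0 hx
    rw [hzero 0 (by omega), sub_zero, Real.norm_eq_abs, Real.norm_eq_abs] at hmvt
    have hle : |x - z 0| ≤ b - a := abs_sub_le_of_le_of_le hx.1 hx.2 hz0.1 hz0.2
    calc |G 0 x| ≤ (b - a) ^ k * D * |x - z 0| := hmvt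
      _ ≤ (b - a) ^ k * D * (b - a) :=
        mul_le_mul_of_nonneg_left hle ((abs_nonneg _).trans (hderiv x hx))
      _ = (b - a) ^ (k + 1) * D := by ring

lemma ContDiff.hasDerivAt_iteratedDeriv_top {F : ℝ → ℂ} (hF : ContDiff ℝ (⊤ : ℕ∞) F) (j : ℕ)
    (x : ℝ) : HasDerivAt (iteratedDeriv j F) (iteratedDeriv (j + 1) F x) x := by
  rw [iteratedDeriv_succ]
  exact ((hF.differentiable_iteratedDeriv j (mod_cast ENat.natCast_lt_top j)) x).hasDerivAt

lemma norm_le_of_zeros_of_norm_iteratedDeriv_le {F : ℝ → ℂ} (hF : ContDiff ℝ (⊤ : ℕ∞) F)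
    {k : ℕ} {a b D : ℝ} {z : ℕ → ℝ}
    (hz : ∀ i, i + 1 < k → z i < z (i + 1)) (hzmem : ∀ i < k, z i ∈ Set.Icc a b)
    (hzero : ∀ i < k, F (z i) = 0) (hD : ∀ x, ‖iteratedDeriv k F x‖ ≤ D)
    {x : ℝ} (hx : x ∈ Set.Icc a b) : ‖F x‖ ≤ 2 * ((b - a) ^ k * D) := by
  have hre : |(F x).re| ≤ (b - a) ^ k * D := by
    refine abs_le_of_zeros_of_hasDerivAt k (G := fun j y ↦ (iteratedDeriv j F y).re) ?_ hz hzmem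
      ?_ ?_ x hx
    · intro j y
      exact (Complex.reCLM.hasFDerivAt.comp_hasDerivAt y (hF.hasDerivAt_iteratedDeriv_top j y))
    · intro i hi
      simp [hzero i hi]
    · exact fun y _ ↦ (Complex.abs_re_le_norm _).trans (hD y)
  have him : |(F x).im| ≤ (b - a) ^ k * D := by
    refine abs_le_of_zeros_of_hasDerivAt k (G := fun j y ↦ (iteratedDeriv j F y).im) ?_ hz hzmem
      ?_ ?_ x hx
    · intro j y
      exact (Complex.imCLM.hasFDerivAt.comp_hasDerivAt y (hF.hasDerivAt_iteratedDeriv_top j y))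
    · intro i hi
      simp [hzero i hi]
    · exact fun y _ ↦ (Complex.abs_im_le_norm _).trans (hD y)
  linarith [Complex.norm_le_abs_re_add_abs_im (F x)]

lemma norm_le_of_symmetric_zeros {F : ℝ → ℂ} (hF : ContDiff ℝ (⊤ : ℕ∞) F)
    {k N : ℕ} {D : ℝ} {z : ℕ → ℝ} (hz : StrictMono z) (hpos : ∀ n, F (z n) = 0)
    (hneg : ∀ n, F (-z n) = 0) (hD : ∀ x, ‖iteratedDeriv k F x‖ ≤ D)
    {x : ℝ} (hx : |x| ∈ Set.Icc (z N) (z (N + k))) :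
    ‖F x‖ ≤ 2 * ((z (N + k) - z N) ^ k * D) := by
  have hstep : ∀ i, i + 1 < k → z (N + i) < z (N + (i + 1)) := fun i _ ↦ hz (by omega)
  have hmem : ∀ i < k, z (N + i) ∈ Set.Icc (z N) (z (N + k)) := fun i hi ↦
    ⟨hz.monotone (by omega), hz.monotone (by omega)⟩
  rcases le_total 0 x with h | h
  · rw [abs_of_nonneg h] at hx
    exact norm_le_of_zeros_of_norm_iteratedDeriv_le hF hstep hmem (fun i _ ↦ hpos _) hD hx
  · rw [abs_of_nonpos h] at hx
    have := norm_le_of_zeros_of_norm_iteratedDeriv_le (F := fun y ↦ F (-y))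
      (hF.comp contDiff_neg) (D := D) hstep hmem (fun i _ ↦ hneg _) (fun y ↦ by
        rw [iteratedDeriv_comp_neg, norm_smul]
        simpa using hD (-y)) hx
    simpa using this

lemma norm_iteratedDeriv_fourier_le (g : SchwartzMap ℝ ℂ) {k : ℕ} {B : ℝ}
    (hB : WeightedBound g (k + 2) B) (x : ℝ) :
    ‖iteratedDeriv k (𝓕 (g : ℝ → ℂ)) x‖ ≤ 4 * 8 ^ k * B := by
  have hint : ∀ n : ℕ, (n : ℕ∞) ≤ (⊤ : ℕ∞) → Integrable (fun x : ℝ ↦ x ^ n • g x) := by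
    intro n _
    have h := g.integrable_pow_mul volume n
    refine (integrable_norm_iff (by fun_prop)).1 ?_
    simpa [norm_smul] using h
  rw [Real.iteratedDeriv_fourier (N := ⊤) hint le_top]
  have hpt : ∀ y : ℝ, ‖(-2 * Real.pi * Complex.I * y) ^ k • g y‖ ≤
      (8 ^ k * B) * (1 + y ^ 2)⁻¹ := by
    intro y
    have h1 : ‖(-2 * Real.pi * Complex.I * y : ℂ)‖ ≤ 8 * (1 + |y|) := by
      simp only [norm_mul, norm_neg, Complex.norm_real, Complex.norm_I, Complex.norm_ofNat,
        Real.norm_eq_abs, abs_of_pos Real.pi_pos, mul_one]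
      nlinarith [Real.pi_le_four, abs_nonneg y, Real.pi_pos]
    rw [norm_smul, norm_pow, ← div_eq_mul_inv, le_div_iff₀ (by positivity)]
    calc ‖(-2 * Real.pi * Complex.I * y : ℂ)‖ ^ k * ‖g y‖ * (1 + y ^ 2)
        ≤ (8 * (1 + |y|)) ^ k * ‖g y‖ * (1 + |y|) ^ 2 := by
          gcongr
          nlinarith [abs_nonneg y, sq_abs y]
      _ = 8 ^ k * ((1 + |y|) ^ (k + 2) * ‖g y‖) := by rw [mul_pow]; ring
      _ ≤ 8 ^ k * B := by gcongr; exact hB y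
  have hB0 := hB.nonneg
  calc ‖𝓕 (fun y : ℝ ↦ (-2 * Real.pi * Complex.I * y) ^ k • g y) x‖
      ≤ ∫ y : ℝ, ‖(-2 * Real.pi * Complex.I * y) ^ k • g y‖ := by
        rw [Real.fourier_real_eq]
        refine (norm_integral_le_integral_norm _).trans_eq ?_
        simp
    _ ≤ ∫ y : ℝ, (8 ^ k * B) * (1 + y ^ 2)⁻¹ :=
        integral_mono_of_nonneg (Filter.Eventually.of_forall fun y ↦ norm_nonneg _)
          (integrable_inv_one_add_sq.const_mul _) (Filter.Eventually.of_forall hpt)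
    _ = 8 ^ k * B * Real.pi := by rw [integral_const_mul, integral_univ_inv_one_add_sq]
    _ ≤ 8 ^ k * B * 4 := by gcongr; exact Real.pi_le_four
    _ = 4 * 8 ^ k * B := by ring

lemma norm_fourier_le_of_symmetric_zeros (g F : SchwartzMap ℝ ℂ)
    (hFg : (F : ℝ → ℂ) = 𝓕 (g : ℝ → ℂ))
    {k N : ℕ} {B : ℝ} (hB : WeightedBound g (k + 2) B) {z : ℕ → ℝ} (hz : StrictMono z)
    (hpos : ∀ n, F (z n) = 0) (hneg : ∀ n, F (-z n) = 0)
    {x L : ℝ} (hx : |x| ∈ Set.Icc (z N) (z (N + k))) (hL : z (N + k) - z N ≤ L) :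
    ‖F x‖ ≤ 8 * (8 * L) ^ k * B := by
  have h := norm_le_of_symmetric_zeros (F.smooth ⊤) hz hpos hneg
    (fun y ↦ hFg ▸ norm_iteratedDeriv_fourier_le g hB y) hx
  have hB0 := hB.nonneg
  have h0 : 0 ≤ z (N + k) - z N := sub_nonneg.2 (hx.1.trans hx.2)
  calc ‖F x‖ ≤ 2 * ((z (N + k) - z N) ^ k * (4 * 8 ^ k * B)) := h
    _ ≤ 2 * (L ^ k * (4 * 8 ^ k * B)) := by gcongr
    _ = 8 * (8 * L) ^ k * B := by rw [mul_pow]; ring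

lemma strictMono_log_nat_succ : StrictMono fun n : ℕ ↦ Real.log (n + 1) := fun m n h ↦
  Real.log_lt_log (by positivity) (by simpa using h)

lemma norm_le_of_log_zeros (g F : SchwartzMap ℝ ℂ) (hFg : (F : ℝ → ℂ) = 𝓕 (g : ℝ → ℂ))
    (hF : ∀ n : ℕ, F (Real.log (n + 1)) = 0 ∧ F (-Real.log (n + 1)) = 0)
    {k : ℕ} (hk : 1 ≤ k) {B : ℝ} (hB : WeightedBound g (k + 2) B) (x : ℝ) :
    ‖F x‖ ≤ 8 * (16 * k * Real.exp (-|x|)) ^ k * B := by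
  set y := |x|
  have hy : 0 ≤ y := abs_nonneg x
  have hfl : 1 ≤ ⌊Real.exp y⌋₊ := Nat.one_le_floor_iff _ |>.2 (Real.one_le_exp hy)
  obtain ⟨N, hN⟩ : ∃ N, ⌊Real.exp y⌋₊ = N + 1 := ⟨_, (Nat.sub_add_cancel hfl).symm⟩
  have h1 : (N + 1 : ℝ) ≤ Real.exp y := by
    have := Nat.floor_le (Real.exp_pos y).le
    rw [hN] at this
    exact_mod_cast this
  have h2 : Real.exp y < N + 1 + 1 := by
    have := Nat.lt_floor_add_one (Real.exp y)
    rw [hN] at this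
    exact_mod_cast this
  have hk' : (1 : ℝ) ≤ k := by exact_mod_cast hk
  have hN0 : (0 : ℝ) ≤ N := Nat.cast_nonneg N
  have := norm_fourier_le_of_symmetric_zeros g F hFg (N := N) (x := x)
    (L := 2 * k * Real.exp (-y)) hB strictMono_log_nat_succ
    (fun n ↦ (hF n).1) (fun n ↦ (hF n).2) ⟨?_, ?_⟩ ?_
  · convert this using 3
    ring
  · exact (Real.log_le_iff_le_exp (by positivity)).2 h1
  · refine (Real.le_log_iff_exp_le (by positivity)).2 ?_
    push_cast
    linarith
  · rw [← Real.log_div (by positivity) (by positivity)]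
    refine (Real.log_le_sub_one_of_pos (by positivity)).trans ?_
    rw [Real.exp_neg]
    have : (((N + k : ℕ) : ℝ) + 1) / (N + 1) - 1 = k / (N + 1) := by
      push_cast
      field_simp
      ring
    rw [this, ← div_eq_mul_inv, div_le_div_iff₀ (by positivity) (Real.exp_pos y)]
    nlinarith

lemma norm_le_of_rpow_zeros (g F : SchwartzMap ℝ ℂ) (hFg : (F : ℝ → ℂ) = 𝓕 (g : ℝ → ℂ))
    {α : ℝ} (hα0 : 0 < α) (hα1 : α < 1)
    (hF : ∀ n : ℕ, F ((n : ℝ) ^ α) = 0 ∧ F (-(n : ℝ) ^ α) = 0)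
    {m : ℕ} (hm : 1 ≤ m) {B : ℝ} (hB : WeightedBound g (m + 2) B) {x : ℝ} (hx : 1 ≤ |x|) :
    ‖F x‖ ≤ 8 * (16 * m * |x| ^ (-((1 - α) / α))) ^ m * B := by
  set y := |x|
  have hy0 : 0 < y := by linarith
  set u := y ^ α⁻¹
  have hu : 1 ≤ u := Real.one_le_rpow hx (by positivity)
  have huy : u ^ α = y := Real.rpow_inv_rpow hy0.le hα0.ne'
  set N := ⌊u⌋₊
  have hfl : 1 ≤ N := Nat.one_le_floor_iff _ |>.2 hu
  have hN1 : (1 : ℝ) ≤ N := by exact_mod_cast hfl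
  have hN0 : (0 : ℝ) < N := by linarith
  have h1 : (N : ℝ) ≤ u := Nat.floor_le (by linarith)
  have h2 : u < N + 1 := Nat.lt_floor_add_one u
  have hm' : (1 : ℝ) ≤ m := by exact_mod_cast hm
  have hmono : StrictMono fun n : ℕ ↦ (n : ℝ) ^ α := fun a b h ↦
    Real.rpow_lt_rpow (Nat.cast_nonneg a) (by exact_mod_cast h) hα0
  have := norm_fourier_le_of_symmetric_zeros g F hFg (N := N) (x := x)
    (L := 2 * m * y ^ (-((1 - α) / α))) hB hmono
    (fun n ↦ (hF n).1) (fun n ↦ (hF n).2) ⟨?_, ?_⟩ ?_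
  · convert this using 3
    ring
  · change (N : ℝ) ^ α ≤ y
    rw [← huy]
    exact Real.rpow_le_rpow hN0.le h1 hα0.le
  · change y ≤ ((N + m : ℕ) : ℝ) ^ α
    rw [← huy]
    refine Real.rpow_le_rpow (by linarith) ?_ hα0.le
    push_cast
    linarith
  · have hyu : y ^ (-((1 - α) / α)) = u ^ (α - 1) := by
      rw [← Real.rpow_mul hy0.le]
      congr 1
      field_simp
      ring
    have hsplit : ((N + m : ℕ) : ℝ) ^ α = (N : ℝ) ^ α * (1 + m / N) ^ α := by
      rw [← Real.mul_rpow hN0.le (by positivity)]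
      congr 1
      push_cast
      field_simp
    have hbern : (1 + (m : ℝ) / N) ^ α ≤ 1 + m / N := by
      have h := rpow_one_add_le_one_add_mul_self (s := (m : ℝ) / N)
        (by linarith [show 0 ≤ (m : ℝ) / N by positivity]) hα0.le hα1.le
      have : α * ((m : ℝ) / N) ≤ 1 * (m / N) := by gcongr
      linarith
    have hNu : (N : ℝ) ^ (α - 1) ≤ 2 * u ^ (α - 1) := by
      have h3 : (N : ℝ) ^ (α - 1) ≤ (u / 2) ^ (α - 1) :=
        Real.rpow_le_rpow_of_nonpos (by linarith) (by linarith) (by linarith)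
      refine h3.trans ?_
      rw [Real.div_rpow (by linarith) (by norm_num), div_eq_mul_inv, mul_comm,
        ← Real.rpow_neg (by norm_num)]
      gcongr
      calc (2 : ℝ) ^ (-(α - 1)) ≤ 2 ^ (1 : ℝ) :=
            Real.rpow_le_rpow_of_exponent_le (by norm_num) (by linarith)
        _ = 2 := Real.rpow_one 2
    rw [hyu]
    calc ((N + m : ℕ) : ℝ) ^ α - (N : ℝ) ^ α
        ≤ (N : ℝ) ^ α * (1 + m / N) - (N : ℝ) ^ α := by
          rw [hsplit]
          gcongr
      _ = m * (N : ℝ) ^ (α - 1) := by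
          rw [Real.rpow_sub_one hN0.ne']
          ring
      _ ≤ m * (2 * u ^ (α - 1)) := by gcongr
      _ = 2 * m * u ^ (α - 1) := by ring

lemma weightedBound_of_rpow_zeros (g F : SchwartzMap ℝ ℂ) (hFg : (F : ℝ → ℂ) = 𝓕 (g : ℝ → ℂ))
    {α : ℝ} (hα0 : 0 < α) (hα1 : α < 1)
    (hF : ∀ n : ℕ, F ((n : ℝ) ^ α) = 0 ∧ F (-(n : ℝ) ^ α) = 0)
    {r k : ℕ} (hr : 3 ≤ r * ((1 - α) / α)) (hr1 : 1 ≤ r) (hk : 1 ≤ k) {B : ℝ}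
    (hB : WeightedBound g (r * k + 2) B) :
    WeightedBound F (k + 2) (8 * 2 ^ (k + 2) * (16 * r * k) ^ (r * k) * B) := by
  intro x
  have hB0 := hB.nonneg
  have hk' : (1 : ℝ) ≤ k := by exact_mod_cast hk
  have hr' : (1 : ℝ) ≤ r := by exact_mod_cast hr1
  rcases le_total 1 |x| with hx | hx
  · have h := norm_le_of_rpow_zeros g F hFg hα0 hα1 hF (Nat.mul_pos hr1 hk) hB hx
    set y := |x|
    have hy0 : 0 < y := by linarith
    set s := (1 - α) / α
    have hexp : y ^ (k + 2) * (y ^ (-s)) ^ (r * k) ≤ 1 := by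
      rw [← Real.rpow_natCast, ← Real.rpow_natCast, ← Real.rpow_mul hy0.le,
        ← Real.rpow_add hy0]
      refine Real.rpow_le_one_of_one_le_of_nonpos hx ?_
      push_cast
      nlinarith
    calc (1 + y) ^ (k + 2) * ‖F x‖
        ≤ (2 * y) ^ (k + 2) * (8 * (16 * (r * k : ℕ) * y ^ (-s)) ^ (r * k) * B) := by
          gcongr
          linarith
      _ = 8 * 2 ^ (k + 2) * (16 * r * k) ^ (r * k) * B *
            (y ^ (k + 2) * (y ^ (-s)) ^ (r * k)) := by
          push_cast
          simp only [mul_pow]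
          ring
      _ ≤ _ := mul_le_of_le_one_right (by positivity) hexp
  · have h := norm_iteratedDeriv_fourier_le g (k := 0) (hB.mono (by omega)) x
    rw [iteratedDeriv_zero, ← hFg] at h
    have hone : (1 : ℝ) ≤ (16 * r * k) ^ (r * k) := one_le_pow₀ (by nlinarith)
    calc (1 + |x|) ^ (k + 2) * ‖F x‖
        ≤ 2 ^ (k + 2) * (4 * 8 ^ 0 * B) := by
          gcongr
          linarith
      _ ≤ 8 * 2 ^ (k + 2) * 1 * B := by
          have : 0 ≤ 2 ^ (k + 2) * B := by positivity
          nlinarith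
      _ ≤ _ := by gcongr

lemma weightedBound_of_log_zeros (g F : SchwartzMap ℝ ℂ) (hFg : (F : ℝ → ℂ) = 𝓕 (g : ℝ → ℂ))
    (hF : ∀ n : ℕ, F (Real.log (n + 1)) = 0 ∧ F (-Real.log (n + 1)) = 0)
    {q k : ℕ} (hq : 1 ≤ q) (hk : 1 ≤ k) {B : ℝ} (hB : WeightedBound g (k + 2) B) :
    WeightedBound F (q * k) (8 * q ^ (q * k) * (16 * k) ^ k * B) := by
  intro x
  have h := norm_le_of_log_zeros g F hFg hF hk hB x
  have hB0 := hB.nonneg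
  set y := |x|
  have hy : 0 ≤ y := abs_nonneg x
  have hq' : (1 : ℝ) ≤ q := by exact_mod_cast hq
  have hbase : 1 + y ≤ q * Real.exp (y / q) := by
    have h1 := Real.add_one_le_exp (y / q)
    calc 1 + y ≤ q * (y / q + 1) := by field_simp; linarith
      _ ≤ _ := by gcongr
  have hpow : (1 + y) ^ (q * k) ≤ q ^ (q * k) * Real.exp y ^ k := by
    calc (1 + y) ^ (q * k) ≤ (q * Real.exp (y / q)) ^ (q * k) := by gcongr
      _ = _ := by
        rw [mul_pow, pow_mul (Real.exp _), ← Real.exp_nat_mul, mul_div_cancel₀ _ (by positivity)]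
  calc (1 + y) ^ (q * k) * ‖F x‖
      ≤ (q ^ (q * k) * Real.exp y ^ k) * (8 * (16 * k * Real.exp (-y)) ^ k * B) := by gcongr
    _ = 8 * q ^ (q * k) * (16 * k) ^ k * B * (Real.exp y * Real.exp (-y)) ^ k := by
        simp only [mul_pow]
        ring
    _ = _ := by rw [← Real.exp_add, add_neg_cancel, Real.exp_zero, one_pow, mul_one]

/-- If bounds improve as in `h`, then iterating along `k = 2 ^ i` gives decay of every order. -/
lemma exists_exp_decay_of_weightedBound_improvement {F : ℝ → ℂ} {t : ℕ} (ht : 1 ≤ t)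
    (hF : ∃ B, WeightedBound F t B)
    (h : ∀ q : ℕ, 1 ≤ q → ∃ C : ℝ, 1 ≤ C ∧ ∀ k : ℕ, 1 ≤ k → ∀ B : ℝ,
      WeightedBound F (t * k) B → WeightedBound F (q * k) (C ^ k * (k : ℝ) ^ (t * k) * B))
    (A : ℝ) (hA : 1 < A) :
    ∃ C > 0, ∃ c > 0, ∀ x : ℝ, ‖F x‖ ≤ C * Real.exp (-c * |x| ^ A) := by
  obtain ⟨B, hB⟩ := hF
  have hB0 := hB.nonneg
  obtain ⟨C₁, hC₁, hstep⟩ := h (t * 2) (by omega)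
  have hdyadic : ∀ i : ℕ, WeightedBound F (t * 2 ^ i)
      (C₁ ^ 2 ^ i * ((2 ^ i : ℕ) : ℝ) ^ (t * 2 ^ i) * B) := by
    intro i
    induction i with
    | zero =>
      intro x
      have := hB x
      simp only [pow_zero, mul_one, pow_one, Nat.cast_one, one_pow]
      nlinarith
    | succ i ih =>
      intro x
      have hx := hstep (2 ^ i) Nat.one_le_two_pow _ ih x
      rw [pow_succ' 2 i, ← mul_assoc]
      refine hx.trans ?_
      set k := 2 ^ i
      have hle : (k : ℝ) ≤ ((2 * k : ℕ) : ℝ) := by exact_mod_cast (by omega)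
      calc C₁ ^ k * (k : ℝ) ^ (t * k) * (C₁ ^ k * (k : ℝ) ^ (t * k) * B)
          = C₁ ^ (2 * k) * (k : ℝ) ^ (t * 2 * k) * B := by ring
        _ ≤ _ := by gcongr
  obtain ⟨p, hp⟩ := exists_nat_ge A
  have hp1 : 1 ≤ p := by
    have : (1 : ℝ) < p := hA.trans_le hp
    exact_mod_cast this.le
  obtain ⟨C₂, hC₂, hq⟩ := h (2 * t * p) (Nat.mul_pos (by omega) hp1)
  set E : ℝ := C₂ * C₁ * Real.exp 1
  have hE : 1 ≤ E := one_le_mul_of_one_le_of_one_le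
    (one_le_mul_of_one_le_of_one_le hC₂ hC₁) (Real.one_le_exp zero_le_one)
  have hE0 : 0 < E := by linarith
  refine ⟨(B + 1) * Real.exp 1, by positivity, 1 / (2 * E), by positivity, fun x ↦ ?_⟩
  set v := 1 + |x|
  have hv1 : 1 ≤ v := by linarith [abs_nonneg x]
  have hv0 : 0 < v := by linarith
  have hAv : |x| ^ A ≤ v ^ p := by
    calc |x| ^ A ≤ v ^ A := Real.rpow_le_rpow (abs_nonneg x) (by linarith) (by linarith)
      _ ≤ v ^ (p : ℝ) := Real.rpow_le_rpow_of_exponent_le hv1 hp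
      _ = v ^ p := Real.rpow_natCast v p
  set Y := v ^ p / E with hYdef
  have hexpY : Real.exp (-(Y / 2)) ≤ Real.exp (-(1 / (2 * E)) * |x| ^ A) := by
    refine Real.exp_le_exp.2 ?_
    have : Y / 2 = 1 / (2 * E) * v ^ p := by rw [hYdef]; field_simp
    rw [this, neg_mul]
    gcongr
  suffices hY : ‖F x‖ ≤ B * Real.exp 1 * Real.exp (-(Y / 2)) by
    refine hY.trans ?_
    gcongr
    linarith
  rcases lt_or_ge Y 1 with hY | hY
  · calc ‖F x‖ ≤ v ^ t * ‖F x‖ := le_mul_of_one_le_left (norm_nonneg _) (one_le_pow₀ hv1)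
      _ ≤ B := hB x
      _ ≤ B * (Real.exp 1 * Real.exp (-(Y / 2))) := by
        refine le_mul_of_one_le_right hB0 ?_
        rw [← Real.exp_add]
        exact Real.one_le_exp (by linarith)
      _ = _ := by ring
  · obtain ⟨i, hi1, hi2⟩ := exists_nat_pow_near hY one_lt_two
    have hx := hq (2 ^ i) Nat.one_le_two_pow _ (hdyadic i) x
    rw [pow_succ] at hi2
    set k := 2 ^ i with hkdef
    have hkY : (k : ℝ) ≤ Y := by rw [hkdef]; exact_mod_cast hi1
    have hkY2 : Y < (k : ℝ) * 2 := by rw [hkdef]; exact_mod_cast hi2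
    have hkv : E * (k : ℝ) ^ (2 * t) ≤ v ^ (2 * t * p) := by
      have hkE : (k : ℝ) * E ≤ v ^ p := by rwa [hYdef, le_div_iff₀ hE0] at hkY
      calc E * (k : ℝ) ^ (2 * t) ≤ E ^ (2 * t) * (k : ℝ) ^ (2 * t) := by
            gcongr
            exact le_self_pow₀ hE (by omega)
        _ = ((k : ℝ) * E) ^ (2 * t) := by rw [mul_pow]; ring
        _ ≤ (v ^ p) ^ (2 * t) := by gcongr
        _ = v ^ (2 * t * p) := by rw [← pow_mul, mul_comm]
    set W := v ^ (2 * t * p)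
    have hW : 0 < W := by positivity
    have hxk : W ^ k * ‖F x‖ ≤ (C₂ * C₁ * (k : ℝ) ^ (2 * t)) ^ k * B := by
      rw [← pow_mul]
      refine hx.trans_eq ?_
      simp only [mul_pow, ← pow_mul]
      ring
    have hmain : W ^ k * ‖F x‖ ≤ W ^ k * (Real.exp (-k) * B) := by
      refine hxk.trans ?_
      have : C₂ * C₁ * (k : ℝ) ^ (2 * t) ≤ W * Real.exp (-1) := by
        rw [Real.exp_neg, ← div_eq_mul_inv, le_div_iff₀ (Real.exp_pos 1)]
        refine le_trans (le_of_eq ?_) hkv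
        ring
      calc (C₂ * C₁ * (k : ℝ) ^ (2 * t)) ^ k * B ≤ (W * Real.exp (-1)) ^ k * B := by gcongr
        _ = W ^ k * (Real.exp (-k) * B) := by
          rw [mul_pow, ← Real.exp_nat_mul]
          ring_nf
    calc ‖F x‖ ≤ Real.exp (-k) * B := le_of_mul_le_mul_left hmain (by positivity)
      _ ≤ Real.exp (1 + -(Y / 2)) * B := by
          gcongr
          linarith
      _ = _ := by rw [Real.exp_add]; ring

lemma fourierTransform_eq_fourierInv (f : SchwartzMap ℝ ℂ) (ξ : ℝ) :
    fourierTransform f ξ = (𝓕⁻ f : SchwartzMap ℝ ℂ) ξ := by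
  rw [SchwartzMap.fourierInv_coe, Real.fourierInv_eq', fourierTransform]
  congr 1
  ext x
  rw [smul_eq_mul, mul_comm]
  congr 2
  simp only [RCLike.inner_apply, conj_trivial]
  push_cast
  ring

theorem superexponential_decay_from_log_zeros (α : ℝ) (hα0 : 0 < α) (hα1 : α < 1)
    (f : SchwartzMap ℝ ℂ)
    (hf : ∀ n : ℕ, f (Real.log (n + 1)) = 0 ∧ f (-Real.log (n + 1)) = 0)
    (hfhat : ∀ n : ℕ, fourierTransform f ((n : ℝ) ^ α) = 0 ∧
      fourierTransform f (-(n : ℝ) ^ α) = 0) :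
    ∀ A : ℝ, 1 < A → ∃ C_A > 0, ∃ c_A > 0, ∀ x : ℝ,
      ‖f x‖ ≤ C_A * Real.exp (-c_A * |x| ^ A) := by
  set g : SchwartzMap ℝ ℂ := 𝓕⁻ f
  have hfg : (f : ℝ → ℂ) = 𝓕 (g : ℝ → ℂ) := by
    rw [← SchwartzMap.fourier_coe, FourierTransform.fourier_fourierInv_eq]
  set h : SchwartzMap ℝ ℂ := 𝓕 f
  have hh : (h : ℝ → ℂ) = 𝓕 (f : ℝ → ℂ) := SchwartzMap.fourier_coe f
  have hgh : ∀ ξ, g ξ = h (-ξ) := fun ξ ↦ by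
    rw [hh, ← Real.fourierInv_eq_fourier_neg, ← SchwartzMap.fourierInv_coe]
  have hzero : ∀ n : ℕ, h ((n : ℝ) ^ α) = 0 ∧ h (-(n : ℝ) ^ α) = 0 := by
    intro n
    have hn := hfhat n
    rw [fourierTransform_eq_fourierInv, fourierTransform_eq_fourierInv] at hn
    change g _ = 0 ∧ g _ = 0 at hn
    rw [hgh, hgh, neg_neg] at hn
    exact hn.symm
  have hs : 0 < (1 - α) / α := div_pos (by linarith) hα0
  obtain ⟨r, hr⟩ := exists_nat_ge (3 / ((1 - α) / α))
  have hr3 : 3 ≤ r * ((1 - α) / α) := (div_le_iff₀ hs).1 hr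
  have hr1 : 1 ≤ r := by
    rcases Nat.eq_zero_or_pos r with h0 | h0
    · norm_num [h0] at hr3
    · exact h0
  refine exists_exp_decay_of_weightedBound_improvement (t := r + 2) (by omega)
    (f.exists_weightedBound _) fun q hq ↦ ?_
  have hq' : (1 : ℝ) ≤ q := by exact_mod_cast hq
  have hr' : (1 : ℝ) ≤ r := by exact_mod_cast hr1
  refine ⟨256 * 2 * 16 * (q : ℝ) ^ q * (16 * r) ^ r, ?_, fun k hk B hB ↦ ?_⟩
  · have h1 : (1 : ℝ) ≤ (q : ℝ) ^ q := one_le_pow₀ hq'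
    have h2 : (1 : ℝ) ≤ (16 * r : ℝ) ^ r := one_le_pow₀ (by linarith)
    exact one_le_mul_of_one_le_of_one_le (by linarith) h2
  have hk' : (1 : ℝ) ≤ k := by exact_mod_cast hk
  have hB0 := hB.nonneg
  have hB1 := weightedBound_of_rpow_zeros f h hh hα0 hα1 hzero hr3 hr1 hk
    (hB.mono (by nlinarith : r * k + 2 ≤ (r + 2) * k))
  have hB2 : WeightedBound g _ _ := (funext hgh : (g : ℝ → ℂ) = _) ▸ hB1.comp_neg
  intro x
  refine (weightedBound_of_log_zeros g f hfg hf hq hk hB2 x).trans ?_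
  calc 8 * (q : ℝ) ^ (q * k) * (16 * k) ^ k * (8 * 2 ^ (k + 2) * (16 * r * k) ^ (r * k) * B)
      = 256 * (2 * 16 * (q : ℝ) ^ q * (16 * r) ^ r) ^ k * (k : ℝ) ^ ((r + 1) * k) * B := by
        simp only [mul_pow, ← pow_mul]
        ring
    _ ≤ 256 ^ k * (2 * 16 * (q : ℝ) ^ q * (16 * r) ^ r) ^ k * (k : ℝ) ^ ((r + 2) * k) * B := by
        gcongr
        · exact le_self_pow₀ (by norm_num) (by omega)
        · norm_num
    _ = _ := by
        rw [← mul_pow]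
        ring
end
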